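/- Let G be a finite simple graph in which each edge belongs to at most one even cycle, let V be a subset of the vertices of G, and suppose e is an edge of G that does not lie on any cycle all of whose edges lie in the symmetric difference of two matchings of G with vertex set V. Then either e belongs to every matching of G with vertex set V, or e belongs to no matching of G with vertex set V. -/

import Mathlib

variable {V : Type} [Fintype V] [DecidableEq V]

/-- `M` is a matching of `G`: a finset of edges of `G` that pairwise share no vertex. -/
def IsGMatching (G : SimpleGraph V) (M : Finset (Sym2 V)) : Prop :=
  (M : Set (Sym2 V)) ⊆ G.edgeSet ∧
    (M : Set (Sym2 V)).Pairwise fun e f => ∀ v : V, ¬ (v ∈ e ∧ v ∈ f)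

/-- The set of vertices covered by a finset of edges. -/
def edgeVerts (F : Finset (Sym2 V)) : Set V := {v | ∃ e ∈ F, v ∈ e}

/-- `m_k(G)`: the number of `k`-matchings of `G`. -/
noncomputable def mCount (G : SimpleGraph V) (k : ℕ) : ℕ :=
  Nat.card {M : Finset (Sym2 V) // IsGMatching G M ∧ M.card = k}

/-- `Cy` is the edge set of a cycle of `G`. -/
def IsCycleEdges (G : SimpleGraph V) (Cy : Finset (Sym2 V)) : Prop :=
  ∃ (v : V) (w : G.Walk v v), w.IsCycle ∧ w.edges.toFinset = Cy

/-- `Cy` is the edge set of an even cycle of `G`. -/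
def IsEvenCycleEdges (G : SimpleGraph V) (Cy : Finset (Sym2 V)) : Prop :=
  ∃ (v : V) (w : G.Walk v v), w.IsCycle ∧ Even w.length ∧ w.edges.toFinset = Cy

/-- Each edge of `G` belongs to at most one even cycle of `G`. -/
def EachEdgeInAtMostOneEvenCycle (G : SimpleGraph V) : Prop :=
  ∀ C₁ C₂ : Finset (Sym2 V), IsEvenCycleEdges G C₁ → IsEvenCycleEdges G C₂ →
    ∀ e : Sym2 V, e ∈ C₁ → e ∈ C₂ → C₁ = C₂

theorem IsGMatching.eq_of_mem {G : SimpleGraph V} {M : Finset (Sym2 V)} (hM : IsGMatching G M)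
    {e f : Sym2 V} (he : e ∈ M) (hf : f ∈ M) {v : V} (hve : v ∈ e) (hvf : v ∈ f) : e = f := by
  by_contra hne
  exact hM.2 (Finset.mem_coe.2 he) (Finset.mem_coe.2 hf) hne v ⟨hve, hvf⟩

/-- An edge at `v` in exactly one of two matchings covering the same vertices is paired with
exactly one edge at `v` in the other matching. -/
theorem IsGMatching.exists_neighborSet_eq_pair {G : SimpleGraph V} {M N : Finset (Sym2 V)}
    (hM : IsGMatching G M) (hN : IsGMatching G N) (hMN : edgeVerts M = edgeVerts N) {v w : V}
    (hvM : s(v, w) ∈ M) (hvN : s(v, w) ∉ N) :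
    ∃ w', w ≠ w' ∧ {x | s(v, x) ∈ (M ∪ N) \ (M ∩ N)} = {w, w'} := by
  have hv : v ∈ edgeVerts N := hMN ▸ ⟨s(v, w), hvM, Sym2.mem_mk_left v w⟩
  obtain ⟨f, hf, hvf⟩ := hv
  obtain ⟨w', rfl⟩ := Sym2.mem_iff_exists.1 hvf
  have hne : w ≠ w' := by
    rintro rfl
    exact hvN hf
  have uM : ∀ x, s(v, x) ∈ M → x = w := fun x hx =>
    Sym2.congr_right.1 (hM.eq_of_mem hx hvM (Sym2.mem_mk_left v x) (Sym2.mem_mk_left v w))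
  have uN : ∀ x, s(v, x) ∈ N → x = w' := fun x hx =>
    Sym2.congr_right.1 (hN.eq_of_mem hx hf (Sym2.mem_mk_left v x) (Sym2.mem_mk_left v w'))
  refine ⟨w', hne, ?_⟩
  ext x
  simp only [Set.mem_ofPred_eq, Finset.mem_sdiff, Finset.mem_union, Finset.mem_inter,
    Set.mem_insert_iff, Set.mem_singleton_iff]
  constructor
  · rintro ⟨hx | hx, -⟩
    · exact Or.inl (uM x hx)
    · exact Or.inr (uN x hx)
  · rintro (rfl | rfl)
    · exact ⟨Or.inl hvM, fun h => hvN h.2⟩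
    · exact ⟨Or.inr hf, fun h => hne (uM _ h.1).symm⟩

theorem IsGMatching.fromEdgeSet_le {G : SimpleGraph V} {M N : Finset (Sym2 V)}
    (hM : IsGMatching G M) (hN : IsGMatching G N) :
    SimpleGraph.fromEdgeSet (((M ∪ N) \ (M ∩ N) : Finset (Sym2 V)) : Set (Sym2 V)) ≤ G := by
  intro v w h
  rw [SimpleGraph.fromEdgeSet_adj, Finset.mem_coe, Finset.mem_sdiff, Finset.mem_union] at h
  rcases h.1.1 with h | h
  · exact hM.1 h
  · exact hN.1 h

theorem IsGMatching.isCycles_fromEdgeSet {G : SimpleGraph V} {M N : Finset (Sym2 V)}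
    (hM : IsGMatching G M) (hN : IsGMatching G N) (hMN : edgeVerts M = edgeVerts N) :
    (SimpleGraph.fromEdgeSet
      (((M ∪ N) \ (M ∩ N) : Finset (Sym2 V)) : Set (Sym2 V))).IsCycles := by
  rintro v ⟨w, hw⟩
  have hset : (SimpleGraph.fromEdgeSet
      (((M ∪ N) \ (M ∩ N) : Finset (Sym2 V)) : Set (Sym2 V))).neighborSet v =
      {x | s(v, x) ∈ (M ∪ N) \ (M ∩ N)} := by
    ext x
    rw [SimpleGraph.mem_neighborSet, SimpleGraph.fromEdgeSet_adj, Finset.mem_coe]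
    refine ⟨fun h => h.1, fun h => ⟨h, ?_⟩⟩
    rcases Finset.mem_union.1 (Finset.mem_sdiff.1 h).1 with h | h
    · exact (show G.Adj v x from hM.1 h).ne
    · exact (show G.Adj v x from hN.1 h).ne
  rw [hset] at hw ⊢
  have hw' := hw
  rw [Set.mem_ofPred_eq, Finset.mem_sdiff, Finset.mem_union, Finset.mem_inter] at hw'
  rcases hw' with ⟨h | h, hn⟩
  · obtain ⟨w', hne, heq⟩ := hM.exists_neighborSet_eq_pair hN hMN h fun h' => hn ⟨h, h'⟩
    rw [heq, Set.ncard_pair hne]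
  · obtain ⟨w', hne, heq⟩ := hN.exists_neighborSet_eq_pair hM hMN.symm h fun h' => hn ⟨h', h⟩
    rw [Finset.union_comm, Finset.inter_comm, heq, Set.ncard_pair hne]

/-- Every edge of the symmetric difference of two matchings covering the same vertices lies on a
cycle contained in that symmetric difference. -/
theorem IsGMatching.exists_isCycleEdges {G : SimpleGraph V} {M N : Finset (Sym2 V)}
    (hM : IsGMatching G M) (hN : IsGMatching G N) (hMN : edgeVerts M = edgeVerts N)
    {e : Sym2 V} (he : e ∈ (M ∪ N) \ (M ∩ N)) :
    ∃ Cy, IsCycleEdges G Cy ∧ Cy ⊆ (M ∪ N) \ (M ∩ N) ∧ e ∈ Cy := by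
  induction e with | _ v w
  have hle := hM.fromEdgeSet_le hN
  have hvw : v ≠ w := by
    rcases Finset.mem_union.1 (Finset.mem_sdiff.1 he).1 with h | h
    · exact (show G.Adj v w from hM.1 h).ne
    · exact (show G.Adj v w from hN.1 h).ne
  have hadj : (SimpleGraph.fromEdgeSet
      (((M ∪ N) \ (M ∩ N) : Finset (Sym2 V)) : Set (Sym2 V))).Adj v w :=
    (SimpleGraph.fromEdgeSet_adj _).2 ⟨Finset.mem_coe.2 he, hvw⟩
  obtain ⟨u, p, hp, hep⟩ := SimpleGraph.adj_and_reachable_delete_edges_iff_exists_cycle.1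
    ⟨hadj, (hM.isCycles_fromEdgeSet hN hMN).reachable_deleteEdges hadj⟩
  refine ⟨p.edges.toFinset, ⟨u, p.mapLe hle, hp.mapLe hle, ?_⟩, fun f hf => ?_,
    List.mem_toFinset.2 hep⟩
  · rw [SimpleGraph.Walk.edges_mapLe_eq_edges]
  · have hf' := p.edges_subset_edgeSet (List.mem_toFinset.1 hf)
    rw [SimpleGraph.edgeSet_fromEdgeSet] at hf'
    exact Finset.mem_coe.1 hf'.1

/-- Suppose each edge of `G` belongs to at most one even cycle. Let `e`
be an edge of `G` which does not lie on any cycle all of whose edges lie in the symmetric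
difference of two matchings of `G` with vertex set `V₀`. Then either `e` belongs to every
matching of `G` with vertex set `V₀`, or `e` belongs to no matching of `G` with vertex
set `V₀`. -/
theorem stmt19 (G : SimpleGraph V) (hG : EachEdgeInAtMostOneEvenCycle G)
    (V₀ : Set V) (e : Sym2 V) (he : e ∈ G.edgeSet)
    (hno : ¬ ∃ (Cy M₁ M₂ : Finset (Sym2 V)), IsCycleEdges G Cy ∧
        IsGMatching G M₁ ∧ IsGMatching G M₂ ∧
        edgeVerts M₁ = V₀ ∧ edgeVerts M₂ = V₀ ∧
        Cy ⊆ (M₁ ∪ M₂) \ (M₁ ∩ M₂) ∧ e ∈ Cy) :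
    (∀ M : Finset (Sym2 V), IsGMatching G M → edgeVerts M = V₀ → e ∈ M) ∨
    (∀ M : Finset (Sym2 V), IsGMatching G M → edgeVerts M = V₀ → e ∉ M) := by
  by_contra! h
  obtain ⟨⟨N, hN, hNV, heN⟩, M, hM, hMV, heM⟩ := h
  obtain ⟨Cy, hCy, hsub, heCy⟩ := hM.exists_isCycleEdges hN (hMV.trans hNV.symm) (e := e) <|
    Finset.mem_sdiff.2 ⟨Finset.mem_union_left N heM, fun h => heN (Finset.mem_inter.1 h).2⟩
  exact hno ⟨Cy, M, N, hCy, hM, hN, hMV, hNV, hsub, heCy⟩
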